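/- arXiv:2604.05578 — 5 statements merged into one kernel-verified Lean document; each statement's English description precedes it below -/
import Mathlib

section
/- For θ ∈ ℝ let R(θ) be the 2×2 rotation matrix with rows (cos θ, −sin θ) and (sin θ, cos θ), and set A(θ) := R(θ)·diag(0,1)·R(θ)ᵀ, a symmetric positive semidefinite 2×2 matrix with eigenvalues 0 and 1. Then for every continuously differentiable function s : ℝ² → ℝ there exists θ₀ ∈ (0, 2π) such that, with x₀ := (cos θ₀, sin θ₀), the row vector ∇s(x₀) satisfies ∇s(x₀)·A(θ₀) = 0, and in particular ∇s(x₀) A(θ₀) ∇s(x₀)ᵀ = 0. Hence there is no C¹ function s on any domain containing the unit circle for which Ds(x) A Ds(x)ᵀ > 0 holds at every point of the unit circle (with A the above matrix field on the circle). -/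
open Matrix Real

/-- Gradient of a function on `ℝ²`, as a (row) vector of partial derivatives. -/
noncomputable def grad2 (s : (Fin 2 → ℝ) → ℝ) (x : Fin 2 → ℝ) : Fin 2 → ℝ :=
  fun j => fderiv ℝ s x (Pi.single j 1)

/-- The rotation matrix `R(θ)`. -/
noncomputable def Rmat (θ : ℝ) : Matrix (Fin 2) (Fin 2) ℝ :=
  !![Real.cos θ, -Real.sin θ; Real.sin θ, Real.cos θ]

/-- The matrix field `A(θ) = R(θ)·diag(0,1)·R(θ)ᵀ` on the unit circle. -/
noncomputable def AmatCirc (θ : ℝ) : Matrix (Fin 2) (Fin 2) ℝ :=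
  Rmat θ * !![(0 : ℝ), 0; 0, 1] * (Rmat θ)ᵀ

/-- `∇s · A(θ)` is the tangential component of `∇s` times the unit tangent vector. -/
lemma vecMul_AmatCirc (v : Fin 2 → ℝ) (θ : ℝ) :
    vecMul v (AmatCirc θ) =
      (-Real.sin θ * v 0 + Real.cos θ * v 1) • ![-Real.sin θ, Real.cos θ] := by
  ext i
  fin_cases i <;>
    simp [AmatCirc, Rmat, vecMul, dotProduct, Matrix.mul_apply, Fin.sum_univ_two] <;> ring

/-- The derivative of `s` along the unit circle is the tangential component of `∇s`. -/
lemma hasDerivAt_comp_circle {s : (Fin 2 → ℝ) → ℝ} (hs : Differentiable ℝ s) (θ : ℝ) :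
    HasDerivAt (fun t => s ![Real.cos t, Real.sin t])
      (-Real.sin θ * grad2 s ![Real.cos θ, Real.sin θ] 0 +
        Real.cos θ * grad2 s ![Real.cos θ, Real.sin θ] 1) θ := by
  have hc : HasDerivAt (fun t => ![Real.cos t, Real.sin t]) ![-Real.sin θ, Real.cos θ] θ := by
    rw [hasDerivAt_pi]
    intro i
    fin_cases i
    · simpa using Real.hasDerivAt_cos θ
    · simpa using Real.hasDerivAt_sin θ
  have htan : ![-Real.sin θ, Real.cos θ] =
      (-Real.sin θ) • (Pi.single 0 1 : Fin 2 → ℝ) + Real.cos θ • Pi.single 1 1 := by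
    ext i
    fin_cases i <;> simp
  have h := (hs ![Real.cos θ, Real.sin θ]).hasFDerivAt.comp_hasDerivAt θ hc
  rw [htan, map_add, map_smul, map_smul] at h
  exact h

/-- for every `C¹` function `s` on `ℝ²` there is a point of the unit circle at
which `∇s · A = 0`; hence no `C¹` function makes `Ds A Dsᵀ` positive on the whole circle. -/
theorem stmt4 (s : (Fin 2 → ℝ) → ℝ) (hs : ContDiff ℝ 1 s) :
    (∃ θ₀ ∈ Set.Ioo (0 : ℝ) (2 * Real.pi),
      vecMul (grad2 s ![Real.cos θ₀, Real.sin θ₀]) (AmatCirc θ₀) = 0 ∧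
      dotProduct (vecMul (grad2 s ![Real.cos θ₀, Real.sin θ₀]) (AmatCirc θ₀))
        (grad2 s ![Real.cos θ₀, Real.sin θ₀]) = 0) ∧
    ¬ (∀ θ : ℝ,
      0 < dotProduct (vecMul (grad2 s ![Real.cos θ, Real.sin θ]) (AmatCirc θ))
        (grad2 s ![Real.cos θ, Real.sin θ])) := by
  have hd := hasDerivAt_comp_circle (hs.differentiable one_ne_zero)
  obtain ⟨θ₀, hθ₀, h₀⟩ := exists_hasDerivAt_eq_zero Real.two_pi_pos
    (fun θ _ => (hd θ).continuousAt.continuousWithinAt) (by simp) (fun θ _ => hd θ)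
  have hA : vecMul (grad2 s ![Real.cos θ₀, Real.sin θ₀]) (AmatCirc θ₀) = 0 := by
    rw [vecMul_AmatCirc, h₀, zero_smul]
  have hQ : dotProduct (vecMul (grad2 s ![Real.cos θ₀, Real.sin θ₀]) (AmatCirc θ₀))
      (grad2 s ![Real.cos θ₀, Real.sin θ₀]) = 0 := by
    rw [hA, zero_dotProduct]
  exact ⟨⟨θ₀, hθ₀, hA, hQ⟩, fun h => (h θ₀).ne' hQ⟩
end

section
/- Let χ : ℝ → ℝ be a C^∞ function with χ(r) ≥ 0 for all r, χ(r) = 1 for r < 1/2, and χ(r) = 0 for r ≥ 1. Define A : ℝ² → M(2,2) by A(0) := I₂ and, for x ≠ 0, A(x) := I₂ + (χ(|x|) − 1)·(x xᵀ)/|x|², where x is regarded as a column vector. Then: (i) A is C^∞ (indeed smooth) on all of ℝ²; (ii) A(x) is symmetric and positive semidefinite for every x, with eigenvalues χ(|x|) and 1; (iii) A is bounded on ℝ²; and (iv) for |x| = 1 with x = (cos θ, sin θ), A(x) = I₂ − x xᵀ = R(θ)·diag(0,1)·R(θ)ᵀ, where R(θ) is the 2×2 rotation matrix with rows (cos θ,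 −sin θ) and (sin θ, cos θ). -/
open Matrix

/-- The extension `A(x) = I₂ + (χ(|x|) − 1)·x xᵀ/|x|²` (and `A(0) = I₂`) of the matrix field
`R(θ)·diag(0,1)·R(θ)ᵀ` from the unit circle to all of `ℝ²`. -/
noncomputable def AmatExt (χ : ℝ → ℝ) (x : Fin 2 → ℝ) : Matrix (Fin 2) (Fin 2) ℝ :=
  if x = 0 then 1
  else (1 : Matrix (Fin 2) (Fin 2) ℝ) +
    (χ (Real.sqrt (∑ i, x i ^ 2)) - 1) • ((∑ i, x i ^ 2)⁻¹ • vecMulVec x x)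

theorem sum_sq_fin_two_pos {x : Fin 2 → ℝ} (hx : x ≠ 0) : 0 < ∑ i, x i ^ 2 := by
  obtain ⟨i, hi⟩ := Function.ne_iff.mp hx
  exact Finset.sum_pos' (fun j _ => sq_nonneg _) ⟨i, Finset.mem_univ i, sq_pos_of_ne_zero hi⟩

theorem AmatExt_eq (χ : ℝ → ℝ) (x : Fin 2 → ℝ) :
    AmatExt χ x = 1 + (χ (Real.sqrt (∑ i, x i ^ 2)) - 1) •
      ((∑ i, x i ^ 2)⁻¹ • vecMulVec x x) := by
  unfold AmatExt
  split_ifs with h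
  · simp [h]
  · rfl

theorem AmatExt_apply (χ : ℝ → ℝ) (x : Fin 2 → ℝ) (i j : Fin 2) :
    AmatExt χ x i j = (1 : Matrix (Fin 2) (Fin 2) ℝ) i j +
      (χ (Real.sqrt (∑ i, x i ^ 2)) - 1) * ((∑ i, x i ^ 2)⁻¹ * (x i * x j)) := by
  rw [AmatExt_eq]
  simp [vecMulVec_apply]

theorem contDiff_AmatExt_apply {χ : ℝ → ℝ} (hχ : ContDiff ℝ (⊤ : ℕ∞) χ)
    (hχ1 : ∀ r : ℝ, r < 1 / 2 → χ r = 1) (i j : Fin 2) :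
    ContDiff ℝ (⊤ : ℕ∞) (fun x => AmatExt χ x i j) := by
  rw [contDiff_iff_contDiffAt]
  intro x
  have hs : ContDiff ℝ (⊤ : ℕ∞) (fun x : Fin 2 → ℝ => ∑ i, x i ^ 2) := by fun_prop
  by_cases hx : x = 0
  · have hlt : ∀ᶠ y in nhds x, Real.sqrt (∑ i, y i ^ 2) < 1 / 2 := by
      refine (Real.continuous_sqrt.comp hs.continuous).continuousAt.eventually_lt
        continuousAt_const ?_
      simp [hx]
    refine (contDiffAt_const (c := (1 : Matrix (Fin 2) (Fin 2) ℝ) i j)).congr_of_eventuallyEq ?_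
    filter_upwards [hlt] with y hy
    rw [AmatExt_apply, hχ1 _ hy]
    ring
  · have hne := (sum_sq_fin_two_pos hx).ne'
    have hcoord (k : Fin 2) : ContDiffAt ℝ (⊤ : ℕ∞) (fun y : Fin 2 → ℝ => y k) x := by fun_prop
    simp only [AmatExt_apply]
    exact contDiffAt_const.add
      (((hχ.contDiffAt.comp x (hs.contDiffAt.sqrt hne)).sub contDiffAt_const).mul
        ((hs.contDiffAt.inv hne).mul ((hcoord i).mul (hcoord j))))

theorem AmatExt_isSymm (χ : ℝ → ℝ) (x : Fin 2 → ℝ) : (AmatExt χ x).IsSymm := by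
  ext i j
  simp only [transpose_apply, AmatExt_apply, mul_comm (x j) (x i)]
  rw [← transpose_apply (1 : Matrix (Fin 2) (Fin 2) ℝ) i j, transpose_one]

theorem AmatExt_posSemidef {χ : ℝ → ℝ} (hχ0 : ∀ r, 0 ≤ χ r) (x : Fin 2 → ℝ) :
    (AmatExt χ x).PosSemidef := by
  by_cases hx : x = 0
  · rw [AmatExt, if_pos hx]
    exact PosSemidef.one
  · have hs := sum_sq_fin_two_pos hx
    have key : AmatExt χ x = (∑ i, x i ^ 2)⁻¹ • vecMulVec ![-x 1, x 0] (star ![-x 1, x 0]) +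
        (χ (Real.sqrt (∑ i, x i ^ 2)) * (∑ i, x i ^ 2)⁻¹) • vecMulVec x (star x) := by
      ext i j
      rw [AmatExt_apply]
      generalize χ (Real.sqrt (∑ i, x i ^ 2)) = c
      rw [Fin.sum_univ_two] at *
      fin_cases i <;> fin_cases j <;> simp [vecMulVec_apply] <;> field_simp <;> ring
    rw [key]
    exact ((posSemidef_vecMulVec_self_star _).smul (inv_nonneg.mpr hs.le)).add
      ((posSemidef_vecMulVec_self_star _).smul (mul_nonneg (hχ0 _) (inv_nonneg.mpr hs.le)))

theorem det_AmatExt_sub_smul_one {χ : ℝ → ℝ} (hχ1 : ∀ r : ℝ, r < 1 / 2 → χ r = 1)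
    (x : Fin 2 → ℝ) (t : ℝ) :
    (AmatExt χ x - t • (1 : Matrix (Fin 2) (Fin 2) ℝ)).det
      = (χ (Real.sqrt (∑ i, x i ^ 2)) - t) * (1 - t) := by
  by_cases hx : x = 0
  · have h1 : χ 0 = 1 := hχ1 0 (by norm_num)
    simp [det_fin_two, AmatExt, hx, h1]
  · have hs := sum_sq_fin_two_pos hx
    simp only [det_fin_two, Matrix.sub_apply, Matrix.smul_apply, AmatExt_apply]
    generalize χ (Real.sqrt (∑ i, x i ^ 2)) = c
    rw [Fin.sum_univ_two] at *
    simp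
    field_simp
    ring

theorem exists_abs_AmatExt_apply_le {χ : ℝ → ℝ} (hχ : Continuous χ)
    (hχ2 : ∀ r : ℝ, 1 ≤ r → χ r = 0) :
    ∃ C : ℝ, ∀ (x : Fin 2 → ℝ) (i j : Fin 2), |AmatExt χ x i j| ≤ C := by
  obtain ⟨M, hM⟩ := isCompact_Icc.exists_bound_of_continuousOn (s := Set.Icc (0 : ℝ) 1)
    hχ.continuousOn
  have hM0 : 0 ≤ M := (norm_nonneg _).trans (hM 0 (by simp))
  have hχM : ∀ r : ℝ, 0 ≤ r → |χ r| ≤ M := by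
    intro r hr
    rcases le_total r 1 with h | h
    · exact hM r ⟨hr, h⟩
    · simpa [hχ2 r h] using hM0
  refine ⟨1 + (M + 1) * 1, fun x i j => ?_⟩
  rw [AmatExt_apply]
  refine (abs_add_le _ _).trans (add_le_add ?_ ?_)
  · rw [one_apply]
    split_ifs <;> simp
  · rw [abs_mul]
    refine mul_le_mul ?_ ?_ (abs_nonneg _) (by linarith)
    · refine (abs_sub _ _).trans ?_
      simpa using hχM _ (Real.sqrt_nonneg _)
    · have hle (k : Fin 2) : x k ^ 2 ≤ ∑ i, x i ^ 2 :=
        Finset.single_le_sum (f := fun i => x i ^ 2) (fun i _ => sq_nonneg _) (Finset.mem_univ k)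
      have hnn : 0 ≤ ∑ i, x i ^ 2 := Finset.sum_nonneg fun i _ => sq_nonneg _
      rw [abs_mul, abs_inv, abs_of_nonneg hnn, inv_mul_eq_div]
      refine div_le_one_of_le₀ ?_ hnn
      rw [abs_le]
      constructor <;> nlinarith [hle i, hle j, sq_nonneg (x i + x j), sq_nonneg (x i - x j)]

theorem AmatExt_cos_sin {χ : ℝ → ℝ} (hχ : χ 1 = 0) (θ : ℝ) :
    AmatExt χ ![Real.cos θ, Real.sin θ]
      = 1 - vecMulVec ![Real.cos θ, Real.sin θ] ![Real.cos θ, Real.sin θ] := by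
  have hs : ∑ i, (![Real.cos θ, Real.sin θ] : Fin 2 → ℝ) i ^ 2 = 1 := by
    simp [Fin.sum_univ_two]
  rw [AmatExt_eq, hs, Real.sqrt_one, hχ]
  simp [sub_eq_add_neg]

theorem one_sub_vecMulVec_cos_sin (θ : ℝ) :
    1 - vecMulVec ![Real.cos θ, Real.sin θ] ![Real.cos θ, Real.sin θ]
      = Rmat θ * !![(0 : ℝ), 0; 0, 1] * (Rmat θ)ᵀ := by
  ext i j
  fin_cases i <;> fin_cases j <;>
    simp [Rmat, mul_apply, Fin.sum_univ_two] <;>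
    linarith [Real.sin_sq_add_cos_sq θ]

/-- the extended matrix field is smooth, symmetric, positive semidefinite with
eigenvalues `χ(|x|)` and `1`, bounded, and restricts on the unit circle to
`R(θ)·diag(0,1)·R(θ)ᵀ`. -/
theorem stmt6 (χ : ℝ → ℝ) (hχ : ContDiff ℝ (⊤ : ℕ∞) χ) (hχ0 : ∀ r, 0 ≤ χ r)
    (hχ1 : ∀ r : ℝ, r < 1 / 2 → χ r = 1) (hχ2 : ∀ r : ℝ, 1 ≤ r → χ r = 0) :
    (∀ i j, ContDiff ℝ (⊤ : ℕ∞) (fun x => AmatExt χ x i j)) ∧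
    (∀ x : Fin 2 → ℝ,
      (AmatExt χ x).IsSymm ∧ (AmatExt χ x).PosSemidef ∧
      ∀ t : ℝ, (AmatExt χ x - t • (1 : Matrix (Fin 2) (Fin 2) ℝ)).det
          = (χ (Real.sqrt (∑ i, x i ^ 2)) - t) * (1 - t)) ∧
    (∃ Cb : ℝ, ∀ (x : Fin 2 → ℝ) (i j : Fin 2), |AmatExt χ x i j| ≤ Cb) ∧
    (∀ θ : ℝ,
      AmatExt χ ![Real.cos θ, Real.sin θ]
          = 1 - vecMulVec ![Real.cos θ, Real.sin θ] ![Real.cos θ, Real.sin θ] ∧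
      AmatExt χ ![Real.cos θ, Real.sin θ]
          = Rmat θ * !![(0 : ℝ), 0; 0, 1] * (Rmat θ)ᵀ) := by
  exact ⟨contDiff_AmatExt_apply hχ hχ1,
    fun x => ⟨AmatExt_isSymm χ x, AmatExt_posSemidef hχ0 x, det_AmatExt_sub_smul_one hχ1 x⟩,
    exists_abs_AmatExt_apply_le hχ.continuous hχ2,
    fun θ => ⟨AmatExt_cos_sin (hχ2 1 le_rfl) θ,
      (AmatExt_cos_sin (hχ2 1 le_rfl) θ).trans (one_sub_vecMulVec_cos_sin θ)⟩⟩
end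

section
/- Let N be a positive integer and γ : ℝᴺ → ℝᴺ a C² map which is bounded together with its first and second derivatives. Define P : ℝᴺ × ℝ → ℝᴺ × ℝ by P(z, y) := (z + y·γ(z), y). Then there exists r ∈ (0,1) such that: (i) P maps ℝᴺ × [−r, r] bijectively onto ℝᴺ × [−r, r]; equivalently, for every (x, y) ∈ ℝᴺ × [−r, r] there is a unique z ∈ ℝᴺ with x = z + y·γ(z); (ii) the inverse map has the form P⁻¹(x, y) = (ζ(x, y), y) for a function ζ which is C² on ℝᴺ × [−r, r]; and (iii) the derivatives of P⁻¹ up to second order are bounded on ℝᴺ × [−r, r]. -/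
section Shear

theorem isOpen_slab {X : Type*} [TopologicalSpace X] (ρ : ℝ) : IsOpen {p : X × ℝ | |p.2| < ρ} :=
  isOpen_lt (by fun_prop) continuous_const

variable {E : Type*} [NormedAddCommGroup E] [NormedSpace ℝ E]

theorem norm_sub_le_of_norm_fderiv_le {F : Type*} [NormedAddCommGroup F] [NormedSpace ℝ F]
    {f : E → F} {C : ℝ} (hf : Differentiable ℝ f) (hC : ∀ z, ‖fderiv ℝ f z‖ ≤ C) (z w : E) :
    ‖f z - f w‖ ≤ C * ‖z - w‖ :=
  convex_univ.norm_image_sub_le_of_norm_fderiv_le (fun x _ => hf x) (fun x _ => hC x)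
    (Set.mem_univ w) (Set.mem_univ z)

/-- Quantitative injectivity of the shear `(z, y) ↦ (z + y • γ z, y)`. -/
theorem norm_sub_le_of_shear {γ : E → E} {C : ℝ} (hb : ∀ z, ‖γ z‖ ≤ C)
    (hl : ∀ z w, ‖γ z - γ w‖ ≤ C * ‖z - w‖) {y y' : ℝ} (hy : |y| * C ≤ 1 / 2) (z z' : E) :
    ‖z - z'‖ ≤ 2 * (‖(z + y • γ z) - (z' + y' • γ z')‖ + C * |y - y'|) := by
  have key : z - z' = ((z + y • γ z) - (z' + y' • γ z')) - y • (γ z - γ z')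
      - (y - y') • γ z' := by module
  have h1 : ‖y • (γ z - γ z')‖ ≤ 1 / 2 * ‖z - z'‖ := by
    rw [norm_smul, Real.norm_eq_abs]
    calc |y| * ‖γ z - γ z'‖ ≤ |y| * (C * ‖z - z'‖) := by gcongr; exact hl z z'
      _ = |y| * C * ‖z - z'‖ := by ring
      _ ≤ _ := by gcongr
  have h2 : ‖(y - y') • γ z'‖ ≤ C * |y - y'| := by
    rw [norm_smul, Real.norm_eq_abs, mul_comm]
    gcongr
    exact hb z'
  have h3 := norm_sub_le (((z + y • γ z) - (z' + y' • γ z')) - y • (γ z - γ z')) ((y - y') • γ z')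
  have h4 := norm_sub_le ((z + y • γ z) - (z' + y' • γ z')) (y • (γ z - γ z'))
  rw [← key] at h3
  linarith

theorem exists_eq_add_smul [CompleteSpace E] {γ : E → E} {C : ℝ}
    (hl : ∀ z w, ‖γ z - γ w‖ ≤ C * ‖z - w‖) {y : ℝ} (hy : |y| * C ≤ 1 / 2) (x : E) :
    ∃ z, z + y • γ z = x := by
  have hc : ContractingWith (1 / 2) (fun z => x - y • γ z) := by
    refine ⟨by rw [← NNReal.coe_lt_coe]; norm_num, LipschitzWith.of_dist_le_mul fun z w => ?_⟩
    rw [dist_eq_norm, dist_eq_norm, show x - y • γ z - (x - y • γ w) = y • (γ w - γ z) by module,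
      norm_smul, Real.norm_eq_abs, norm_sub_rev z]
    calc |y| * ‖γ w - γ z‖ ≤ |y| * (C * ‖w - z‖) := by gcongr; exact hl w z
      _ = |y| * C * ‖w - z‖ := by ring
      _ ≤ 1 / 2 * ‖w - z‖ := by gcongr
      _ = _ := by norm_num
  have h := hc.fixedPoint_isFixedPt
  exact ⟨_, (sub_eq_iff_eq_add.mp h.eq).symm⟩

open ContinuousLinearMap in
/-- The derivative of the shear `(z, y) ↦ (z + y • γ z, y)`, for `A = 1 + y • γ' z` and `v = γ z`,
as an equivalence. -/
theorem exists_shear_equiv (A : (E →L[ℝ] E)ˣ) (v : E) :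
    ∃ e : (E × ℝ) ≃L[ℝ] (E × ℝ), (e : (E × ℝ) →L[ℝ] (E × ℝ)) =
      ((A : E →L[ℝ] E).comp (fst ℝ E ℝ) + (snd ℝ E ℝ).smulRight v).prod (snd ℝ E ℝ) := by
  refine ⟨ContinuousLinearEquiv.equivOfInverse
    (((A : E →L[ℝ] E).comp (fst ℝ E ℝ) + (snd ℝ E ℝ).smulRight v).prod (snd ℝ E ℝ))
    ((((A⁻¹ : (E →L[ℝ] E)ˣ) : E →L[ℝ] E).comp
      (fst ℝ E ℝ - (snd ℝ E ℝ).smulRight v)).prod (snd ℝ E ℝ)) ?_ ?_, rfl⟩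
  · rintro ⟨h, k⟩
    have : ((A⁻¹ : (E →L[ℝ] E)ˣ) : E →L[ℝ] E) ((A : E →L[ℝ] E) h) = h :=
      congr($(A.inv_mul) h)
    simp [this]
  · rintro ⟨h, k⟩
    have : ∀ h, (A : E →L[ℝ] E) (((A⁻¹ : (E →L[ℝ] E)ˣ) : E →L[ℝ] E) h) = h := fun h =>
      congr($(A.mul_inv) h)
    simp only [prod_apply, add_apply, comp_apply, coe_fst', coe_snd', smulRight_apply, this,
      sub_apply]
    simp

/-- A right inverse of the shear on an open slab is `C²`. -/
theorem contDiffAt_of_shear_eq [CompleteSpace E] {γ : E → E} {ζ : E × ℝ → E} {C ρ : ℝ}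
    (hγ : ContDiff ℝ 2 γ) (hb : ∀ z, ‖γ z‖ ≤ C) (hb' : ∀ z, ‖fderiv ℝ γ z‖ ≤ C)
    (hρ : ∀ y, |y| < ρ → |y| * C ≤ 1 / 2)
    (hζ : ∀ p : E × ℝ, |p.2| < ρ → ζ p + p.2 • γ (ζ p) = p.1)
    (hlip : ∀ p q : E × ℝ, |p.2| < ρ → |q.2| < ρ → ‖ζ p - ζ q‖ ≤ 2 * (1 + C) * ‖p - q‖)
    {p : E × ℝ} (hp : |p.2| < ρ) : ContDiffAt ℝ 2 ζ p := by
  have hd : Differentiable ℝ γ := hγ.differentiable (by norm_num)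
  have hl := norm_sub_le_of_norm_fderiv_le hd hb'
  have hC : 0 ≤ C := (norm_nonneg _).trans (hb 0)
  have hF : ContDiff ℝ 2 (fun p : E × ℝ => (p.1 + p.2 • γ p.1, p.2)) := by fun_prop
  have hζc : ContinuousOn ζ {p : E × ℝ | |p.2| < ρ} :=
    (LipschitzOnWith.of_dist_le_mul (K := ⟨2 * (1 + C), by positivity⟩) fun x hx y hy => by
      rw [dist_eq_norm, dist_eq_norm]; exact hlip x y hx hy).continuousOn
  let e : OpenPartialHomeomorph (E × ℝ) (E × ℝ) :=
    { toFun := fun p => (p.1 + p.2 • γ p.1, p.2)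
      invFun := fun p => (ζ p, p.2)
      source := {p | |p.2| < ρ}
      target := {p | |p.2| < ρ}
      map_source' := fun p hp => hp
      map_target' := fun p hp => hp
      left_inv' := fun p hp => by
        refine Prod.ext ?_ rfl
        have h := norm_sub_le_of_shear hb hl (y' := p.2) (hρ p.2 hp)
          (ζ (p.1 + p.2 • γ p.1, p.2)) p.1
        rw [hζ (p.1 + p.2 • γ p.1, p.2) hp] at h
        simp only [sub_self, norm_zero, abs_zero, mul_zero, add_zero] at h
        exact sub_eq_zero.mp (norm_le_zero_iff.mp h)
      right_inv' := fun p hp => Prod.ext (hζ p hp) rfl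
      open_source := isOpen_slab ρ
      open_target := isOpen_slab ρ
      continuousOn_toFun := hF.continuous.continuousOn
      continuousOn_invFun := hζc.prodMk continuous_snd.continuousOn }
  have hu : ‖-(p.2 • fderiv ℝ γ (ζ p))‖ < 1 := by
    rw [norm_neg, norm_smul, Real.norm_eq_abs]
    have : |p.2| * ‖fderiv ℝ γ (ζ p)‖ ≤ |p.2| * C := by gcongr; exact hb' _
    linarith [hρ _ hp]
  obtain ⟨A, hA⟩ := isUnit_one_sub_of_norm_lt_one hu
  obtain ⟨e', he'⟩ := exists_shear_equiv A (γ (ζ p))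
  have hder : HasFDerivAt e (e' : (E × ℝ) →L[ℝ] (E × ℝ)) (e.symm p) := by
    rw [he', hA]
    have h1 : HasFDerivAt (fun q : E × ℝ => γ q.1) ((fderiv ℝ γ (ζ p)).comp
        (ContinuousLinearMap.fst ℝ E ℝ)) (ζ p, p.2) :=
      HasFDerivAt.comp (ζ p, p.2) (hd (ζ p)).hasFDerivAt hasFDerivAt_fst
    have h2 := ((hasFDerivAt_fst (𝕜 := ℝ) (p := (ζ p, p.2))).add
      ((hasFDerivAt_snd (𝕜 := ℝ) (p := (ζ p, p.2))).smul h1)).prodMk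
      (hasFDerivAt_snd (𝕜 := ℝ) (p := (ζ p, p.2)))
    refine h2.congr_fderiv ?_
    ext h <;> simp
  exact (e.contDiffAt_symm (n := 2) hp hder hF.contDiffAt).fst

/-- The derivative of a right inverse of the shear on an open slab is Lipschitz. -/
theorem norm_fderiv_sub_le_of_shear_eq {γ : E → E} {ζ : E × ℝ → E} {C ρ L : ℝ}
    (hd : Differentiable ℝ γ) (hb : ∀ z, ‖γ z‖ ≤ C) (hb' : ∀ z, ‖fderiv ℝ γ z‖ ≤ C)
    (hl' : ∀ z w, ‖fderiv ℝ γ z - fderiv ℝ γ w‖ ≤ C * ‖z - w‖) (hρ1 : ρ ≤ 1)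
    (hρ : ∀ y, |y| < ρ → |y| * C ≤ 1 / 2)
    (hζ : ∀ p : E × ℝ, |p.2| < ρ → ζ p + p.2 • γ (ζ p) = p.1)
    (hζd : ∀ p : E × ℝ, |p.2| < ρ → DifferentiableAt ℝ ζ p)
    (hlip : ∀ p q : E × ℝ, |p.2| < ρ → |q.2| < ρ → ‖ζ p - ζ q‖ ≤ L * ‖p - q‖)
    (hL : ∀ p : E × ℝ, |p.2| < ρ → ‖fderiv ℝ ζ p‖ ≤ L)
    {p q : E × ℝ} (hp : |p.2| < ρ) (hq : |q.2| < ρ) :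
    ‖fderiv ℝ ζ p - fderiv ℝ ζ q‖ ≤ 2 * (2 * C * L + C * L * L) * ‖p - q‖ := by
  have hC : 0 ≤ C := (norm_nonneg _).trans (hb 0)
  have hL0 : 0 ≤ L := (norm_nonneg _).trans (hL p hp)
  have hl := norm_sub_le_of_norm_fderiv_le hd hb'
  have eqn : ∀ p : E × ℝ, |p.2| < ρ → fderiv ℝ ζ p + (p.2 • (fderiv ℝ γ (ζ p)).comp (fderiv ℝ ζ p)
      + (ContinuousLinearMap.snd ℝ E ℝ).smulRight (γ (ζ p))) = ContinuousLinearMap.fst ℝ E ℝ := by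
    intro p hp
    have h1 : HasFDerivAt (fun q : E × ℝ => γ (ζ q))
        ((fderiv ℝ γ (ζ p)).comp (fderiv ℝ ζ p)) p :=
      HasFDerivAt.comp p (hd (ζ p)).hasFDerivAt (hζd p hp).hasFDerivAt
    have h2 := (hζd p hp).hasFDerivAt.add ((hasFDerivAt_snd (𝕜 := ℝ) (p := p)).smul h1)
    refine h2.unique ((hasFDerivAt_fst (𝕜 := ℝ) (p := p)).congr_of_eventuallyEq ?_)
    filter_upwards [(isOpen_slab ρ).mem_nhds hp] with q hq using hζ q hq
  set A := fderiv ℝ ζ p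
  set B := fderiv ℝ ζ q
  set G := fderiv ℝ γ (ζ p)
  set H := fderiv ℝ γ (ζ q)
  have key : A - B = -(p.2 • G.comp (A - B)) - ((p.2 - q.2) • G.comp B) - (q.2 • (G - H).comp B)
      - (ContinuousLinearMap.snd ℝ E ℝ).smulRight (γ (ζ p) - γ (ζ q)) := by
    have h := (eqn p hp).trans (eqn q hq).symm
    refine ContinuousLinearMap.ext fun v => ?_
    have hv := congr($h v)
    simp only [add_apply, smul_apply,
      ContinuousLinearMap.comp_apply, ContinuousLinearMap.smulRight_apply,
      sub_apply, neg_apply, map_sub] at hv ⊢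
    linear_combination (norm := module) hv
  have hz := hlip p q hp hq
  have h2 : |p.2 - q.2| ≤ ‖p - q‖ := norm_snd_le (p - q)
  have b1 : ‖p.2 • G.comp (A - B)‖ ≤ 1 / 2 * ‖A - B‖ := by
    rw [norm_smul, Real.norm_eq_abs]
    calc |p.2| * ‖G.comp (A - B)‖ ≤ |p.2| * (C * ‖A - B‖) := by
          gcongr
          exact (G.opNorm_comp_le _).trans (by gcongr; exact hb' _)
      _ = |p.2| * C * ‖A - B‖ := by ring
      _ ≤ _ := by gcongr; exact hρ _ hp
  have b2 : ‖(p.2 - q.2) • G.comp B‖ ≤ ‖p - q‖ * (C * L) := by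
    rw [norm_smul, Real.norm_eq_abs]
    gcongr
    exact (G.opNorm_comp_le _).trans (by gcongr; exacts [hb' _, hL q hq])
  have b3 : ‖q.2 • (G - H).comp B‖ ≤ 1 * (C * (L * ‖p - q‖) * L) := by
    rw [norm_smul, Real.norm_eq_abs]
    gcongr
    · exact hq.le.trans hρ1
    · refine ((G - H).opNorm_comp_le _).trans ?_
      gcongr
      · exact (hl' _ _).trans (by gcongr)
      · exact hL q hq
  have b4 : ‖(ContinuousLinearMap.snd ℝ E ℝ).smulRight (γ (ζ p) - γ (ζ q))‖
      ≤ 1 * (C * (L * ‖p - q‖)) := by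
    rw [ContinuousLinearMap.norm_smulRight_apply]
    gcongr
    · exact ContinuousLinearMap.norm_snd_le ℝ E ℝ
    · exact (hl _ _).trans (by gcongr)
  have h := congr(‖$key‖)
  have n1 := norm_sub_le (-(p.2 • G.comp (A - B)) - ((p.2 - q.2) • G.comp B)
    - (q.2 • (G - H).comp B)) ((ContinuousLinearMap.snd ℝ E ℝ).smulRight (γ (ζ p) - γ (ζ q)))
  have n2 := norm_sub_le (-(p.2 • G.comp (A - B)) - ((p.2 - q.2) • G.comp B))
    (q.2 • (G - H).comp B)
  have n3 := norm_sub_le (-(p.2 • G.comp (A - B))) ((p.2 - q.2) • G.comp B)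
  rw [norm_neg] at n3
  linarith

end Shear

/-- for small `r` the map `P(z,y) = (z + y·γ(z), y)` is a `C²` diffeomorphism of
the slab `ℝᴺ × [−r, r]`, with inverse `(x,y) ↦ (ζ(x,y), y)` whose derivatives up to second
order are bounded. -/
theorem stmt7 (N : ℕ) (hN : 0 < N) (γ : (Fin N → ℝ) → (Fin N → ℝ))
    (hγ : ContDiff ℝ 2 γ) (Cγ : ℝ)
    (hbd : ∀ z, ‖γ z‖ ≤ Cγ ∧ ‖fderiv ℝ γ z‖ ≤ Cγ ∧ ‖fderiv ℝ (fderiv ℝ γ) z‖ ≤ Cγ) :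
    ∃ r ∈ Set.Ioo (0 : ℝ) 1,
      (Set.BijOn (fun p : (Fin N → ℝ) × ℝ => (p.1 + p.2 • γ p.1, p.2))
        {p : (Fin N → ℝ) × ℝ | |p.2| ≤ r} {p : (Fin N → ℝ) × ℝ | |p.2| ≤ r}) ∧
      (∀ (x : Fin N → ℝ) (y : ℝ), |y| ≤ r → ∃! z : Fin N → ℝ, x = z + y • γ z) ∧
      ∃ ζ : (Fin N → ℝ) × ℝ → (Fin N → ℝ), ∃ U : Set ((Fin N → ℝ) × ℝ),
        IsOpen U ∧ {p : (Fin N → ℝ) × ℝ | |p.2| ≤ r} ⊆ U ∧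
        ContDiffOn ℝ 2 ζ U ∧
        (∀ p : (Fin N → ℝ) × ℝ, |p.2| ≤ r → (ζ p + p.2 • γ (ζ p), p.2) = p) ∧
        (∀ p : (Fin N → ℝ) × ℝ, |p.2| ≤ r → ζ (p.1 + p.2 • γ p.1, p.2) = p.1) ∧
        ∃ C : ℝ, ∀ p : (Fin N → ℝ) × ℝ, |p.2| ≤ r →
          ‖fderiv ℝ ζ p‖ ≤ C ∧ ‖fderiv ℝ (fderiv ℝ ζ) p‖ ≤ C := by
  have hb : ∀ z, ‖γ z‖ ≤ Cγ := fun z => (hbd z).1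
  have hb' : ∀ z, ‖fderiv ℝ γ z‖ ≤ Cγ := fun z => (hbd z).2.1
  have hC : 0 ≤ Cγ := (norm_nonneg _).trans (hb 0)
  have hd : Differentiable ℝ γ := hγ.differentiable (by norm_num)
  have hd' : Differentiable ℝ (fderiv ℝ γ) :=
    (hγ.fderiv_right (m := 1) (by norm_num)).differentiable (by norm_num)
  have hl := norm_sub_le_of_norm_fderiv_le hd hb'
  have hl' := norm_sub_le_of_norm_fderiv_le hd' fun z => (hbd z).2.2
  obtain ⟨ρ, hρ0, hρ1, hρC⟩ : ∃ ρ : ℝ, 0 < ρ ∧ ρ ≤ 1 ∧ ρ * Cγ ≤ 1 / 2 := by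
    refine ⟨1 / (2 * (Cγ + 1)), by positivity, ?_, ?_⟩
    · rw [div_le_one (by positivity)]
      linarith
    · rw [div_mul_eq_mul_div, div_le_div_iff₀ (by positivity) (by positivity)]
      linarith
  have hρ : ∀ y, |y| < ρ → |y| * Cγ ≤ 1 / 2 := fun y hy =>
    (mul_le_mul_of_nonneg_right hy.le hC).trans hρC
  have hr : ∀ {y : ℝ}, |y| ≤ ρ / 2 → |y| < ρ := fun h => by linarith
  have hex : ∀ p : (Fin N → ℝ) × ℝ, ∃ z, |p.2| < ρ → z + p.2 • γ z = p.1 := by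
    intro p
    by_cases hp : |p.2| < ρ
    · obtain ⟨z, hz⟩ := exists_eq_add_smul hl (hρ _ hp) p.1
      exact ⟨z, fun _ => hz⟩
    · exact ⟨0, fun h => absurd h hp⟩
  choose ζ hζ using hex
  have hinj : ∀ {y : ℝ}, |y| < ρ → ∀ {z w : Fin N → ℝ}, z + y • γ z = w + y • γ w → z = w := by
    intro y hy z w h
    have h1 := norm_sub_le_of_shear hb hl (y' := y) (hρ y hy) z w
    rw [h] at h1
    simp only [sub_self, norm_zero, abs_zero, mul_zero, add_zero] at h1
    exact sub_eq_zero.mp (norm_le_zero_iff.mp h1)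
  have hlip : ∀ p q : (Fin N → ℝ) × ℝ, |p.2| < ρ → |q.2| < ρ →
      ‖ζ p - ζ q‖ ≤ 2 * (1 + Cγ) * ‖p - q‖ := by
    intro p q hp hq
    have h1 := norm_sub_le_of_shear hb hl (y' := q.2) (hρ _ hp) (ζ p) (ζ q)
    rw [hζ p hp, hζ q hq] at h1
    have h2 : ‖p.1 - q.1‖ ≤ ‖p - q‖ := norm_fst_le (p - q)
    have h3 : Cγ * |p.2 - q.2| ≤ Cγ * ‖p - q‖ :=
      mul_le_mul_of_nonneg_left (norm_snd_le (p - q)) hC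
    linarith
  have hcd : ∀ p : (Fin N → ℝ) × ℝ, |p.2| < ρ → ContDiffAt ℝ 2 ζ p := fun p hp =>
    contDiffAt_of_shear_eq hγ hb hb' hρ hζ hlip hp
  have hL : ∀ p : (Fin N → ℝ) × ℝ, |p.2| < ρ → ‖fderiv ℝ ζ p‖ ≤ 2 * (1 + Cγ) := fun p hp =>
    norm_fderiv_le_of_lip' ℝ (by positivity) <| by
      filter_upwards [(isOpen_slab ρ).mem_nhds hp] with q hq using hlip q p hq hp
  refine ⟨ρ / 2, ⟨by linarith, by linarith⟩, ⟨fun p hp => hp, ?_, ?_⟩, ?_, ζ,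
    {p | |p.2| < ρ}, isOpen_slab ρ, fun p hp => hr hp,
    fun p hp => (hcd p hp).contDiffWithinAt, fun p hp => Prod.ext (hζ p (hr hp)) rfl,
    fun p hp => hinj (hr hp) (hζ (p.1 + p.2 • γ p.1, p.2) (hr hp)), ?_⟩
  · rintro ⟨z, y⟩ hp ⟨w, y'⟩ _ h
    obtain ⟨h1, rfl⟩ := Prod.mk.inj h
    exact Prod.ext (hinj (hr hp) h1) rfl
  · exact fun p hp => ⟨(ζ p, p.2), hp, Prod.ext (hζ p (hr hp)) rfl⟩
  · exact fun x y hy => ⟨ζ (x, y), (hζ (x, y) (hr hy)).symm, fun z hz =>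
      hinj (hr hy) (hz.symm.trans (hζ (x, y) (hr hy)).symm)⟩
  · refine ⟨max (2 * (1 + Cγ))
      (2 * (2 * Cγ * (2 * (1 + Cγ)) + Cγ * (2 * (1 + Cγ)) * (2 * (1 + Cγ)))), fun p hp => ⟨(hL p (hr hp)).trans (le_max_left _ _),
      le_trans (norm_fderiv_le_of_lip' ℝ ?_ ?_) (le_max_right _ _)⟩⟩
    · positivity
    · filter_upwards [(isOpen_slab ρ).mem_nhds (hr hp)] with q hq
      exact norm_fderiv_sub_le_of_shear_eq hd hb hb' hl' hρ1 hρ hζ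
        (fun p hp => (hcd p hp).differentiableAt (by norm_num)) hlip hL hq (hr hp)
end

section
/- Let N be a positive integer, Ω ⊂ ℝᴺ a bounded open set with closure Ω̄, I a nonempty index set, and C > 0. For each i ∈ I let Ã_i : Ω̄ → S(N) (symmetric N×N real matrices) and b̃_i : Ω̄ → ℝᴺ satisfy |Ã_i(x)| ≤ C and |b̃_i(x)| ≤ C for all x ∈ Ω̄. Suppose s : ℝᴺ → ℝ is twice continuously differentiable and Ds(x)·Ã_i(x)·Ds(x)ᵀ ≥ 1 for all i ∈ I and x ∈ Ω̄. Then there exists α ≥ 1 such that the function ψ := e^{α s} (which is C² and satisfies ψ ≥ 1 on Ω̄ if in addition s ≥ 0 there) satisfies, for every i ∈ I and x ∈ Ω̄: −tr(Ã_i(x)·D²ψ(x)) − b̃_i(x)·Dψ(x) ≤ −1. -/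
open Matrix

/-- Euclidean norm of a vector in `ℝⁿ`. -/
noncomputable def vnorm {n : ℕ} (v : Fin n → ℝ) : ℝ := Real.sqrt (∑ j, v j ^ 2)

/-- Frobenius norm of a real matrix. -/
noncomputable def matnorm {m n : ℕ} (A : Matrix (Fin m) (Fin n) ℝ) : ℝ :=
  Real.sqrt (∑ i, ∑ j, A i j ^ 2)

/-- Gradient as a vector of partial derivatives. -/
noncomputable def gradv {n : ℕ} (f : (Fin n → ℝ) → ℝ) (x : Fin n → ℝ) : Fin n → ℝ :=
  fun j => fderiv ℝ f x (Pi.single j 1)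

/-- Hessian matrix of second partial derivatives. -/
noncomputable def hessv {n : ℕ} (f : (Fin n → ℝ) → ℝ) (x : Fin n → ℝ) :
    Matrix (Fin n) (Fin n) ℝ :=
  Matrix.of fun i j => fderiv ℝ (fun y => fderiv ℝ f y (Pi.single j 1)) x (Pi.single i 1)

lemma abs_le_vnorm {n : ℕ} (v : Fin n → ℝ) (j : Fin n) : |v j| ≤ vnorm v :=
  Real.abs_le_sqrt <| Finset.single_le_sum (f := fun k => v k ^ 2)
    (fun _ _ => sq_nonneg _) (Finset.mem_univ j)

lemma abs_le_matnorm {m n : ℕ} (A : Matrix (Fin m) (Fin n) ℝ) (i : Fin m) (j : Fin n) :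
    |A i j| ≤ matnorm A := by
  refine Real.abs_le_sqrt ?_
  calc A i j ^ 2 ≤ ∑ l, A i l ^ 2 :=
        Finset.single_le_sum (f := fun l => A i l ^ 2)
          (fun _ _ => sq_nonneg _) (Finset.mem_univ j)
    _ ≤ ∑ k, ∑ l, A k l ^ 2 :=
        Finset.single_le_sum (f := fun k => ∑ l, A k l ^ 2)
          (fun _ _ => Finset.sum_nonneg fun _ _ => sq_nonneg _) (Finset.mem_univ i)

lemma abs_dotProduct_le {n : ℕ} {v w : Fin n → ℝ} {C : ℝ} (hv : vnorm v ≤ C) :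
    |v ⬝ᵥ w| ≤ C * ∑ j, |w j| := by
  rw [dotProduct, Finset.mul_sum]
  refine (Finset.abs_sum_le_sum_abs _ _).trans (Finset.sum_le_sum fun j _ => ?_)
  rw [abs_mul]
  exact mul_le_mul_of_nonneg_right ((abs_le_vnorm v j).trans hv) (abs_nonneg _)

lemma abs_trace_mul_le {n : ℕ} {A H : Matrix (Fin n) (Fin n) ℝ} {C : ℝ} (hA : matnorm A ≤ C) :
    |trace (A * H)| ≤ C * ∑ i, ∑ j, |H j i| := by
  simp only [trace, diag_apply, mul_apply, Finset.mul_sum]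
  refine (Finset.abs_sum_le_sum_abs _ _).trans (Finset.sum_le_sum fun i _ => ?_)
  refine (Finset.abs_sum_le_sum_abs _ _).trans (Finset.sum_le_sum fun j _ => ?_)
  rw [abs_mul]
  exact mul_le_mul_of_nonneg_right ((abs_le_matnorm A i j).trans hA) (abs_nonneg _)

section ExpComposition

variable {n : ℕ} {s : (Fin n → ℝ) → ℝ}

lemma contDiff_gradv_apply (hs : ContDiff ℝ 2 s) (j : Fin n) :
    ContDiff ℝ 1 (fun x => gradv s x j) :=
  (hs.fderiv_right (m := 1) (by norm_num)).clm_apply contDiff_const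

lemma continuous_hessv_apply (hs : ContDiff ℝ 2 s) (i j : Fin n) :
    Continuous (fun x => hessv s x i j) :=
  ((contDiff_gradv_apply hs j).continuous_fderiv (by norm_num)).clm_apply continuous_const

lemma hasFDerivAt_exp_mul (hs : Differentiable ℝ s) (α : ℝ) (x : Fin n → ℝ) :
    HasFDerivAt (fun y => Real.exp (α * s y)) (Real.exp (α * s x) • α • fderiv ℝ s x) x :=
  ((hs x).hasFDerivAt.const_mul α).exp

lemma gradv_exp_mul (hs : Differentiable ℝ s) (α : ℝ) (x : Fin n → ℝ) :
    gradv (fun y => Real.exp (α * s y)) x = (Real.exp (α * s x) * α) • gradv s x := by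
  ext j
  simp [gradv, (hasFDerivAt_exp_mul hs α x).fderiv, mul_assoc]

lemma hessv_exp_mul (hs : ContDiff ℝ 2 s) (α : ℝ) (x : Fin n → ℝ) :
    hessv (fun y => Real.exp (α * s y)) x =
      Real.exp (α * s x) • (α ^ 2 • vecMulVec (gradv s x) (gradv s x) + α • hessv s x) := by
  have hd : Differentiable ℝ s := hs.differentiable (by norm_num)
  ext i j
  have hgrad : (fun y => fderiv ℝ (fun z => Real.exp (α * s z)) y (Pi.single j 1)) =
      fun y => Real.exp (α * s y) * (α * gradv s y j) := by
    ext y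
    simp [gradv, (hasFDerivAt_exp_mul hd α y).fderiv]
  have hg : HasFDerivAt (fun y => gradv s y j) (fderiv ℝ (fun y => gradv s y j) x) x :=
    ((contDiff_gradv_apply hs j).differentiable (by norm_num) x).hasFDerivAt
  have hmul := (hasFDerivAt_exp_mul hd α x).fun_mul (hg.const_mul α)
  have hH : fderiv ℝ (fun y => gradv s y j) x (Pi.single i 1) = hessv s x i j := rfl
  have hG : fderiv ℝ s x (Pi.single i 1) = gradv s x i := rfl
  calc hessv (fun y => Real.exp (α * s y)) x i j
      = fderiv ℝ (fun y => Real.exp (α * s y) * (α * gradv s y j)) x (Pi.single i 1) := by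
        rw [← hgrad]; rfl
    _ = _ := by
        rw [hmul.fderiv]
        simp only [_root_.add_apply, _root_.smul_apply, smul_eq_mul, hH, hG, Matrix.add_apply,
          Matrix.smul_apply, vecMulVec_apply]
        ring

end ExpComposition

lemma trace_mul_vecMulVec_self {n : ℕ} (A : Matrix (Fin n) (Fin n) ℝ) (v : Fin n → ℝ) :
    trace (A * vecMulVec v v) = vecMul v A ⬝ᵥ v := by
  rw [mul_vecMulVec, trace_vecMulVec, dotProduct_comm, dotProduct_mulVec]

/-- perturbation lemma: under the uniform ellipticity `Ds Ã Dsᵀ ≥ 1` on `Ω̄`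
(with `s ≥ 0` there), for large `α` the function `ψ = e^{αs}` satisfies
`−tr(Ã D²ψ) − b̃·Dψ ≤ −1` on `Ω̄`, uniformly over the index family. -/
theorem stmt13 (N : ℕ) (hN : 0 < N) (Ω : Set (Fin N → ℝ))
    (hΩo : IsOpen Ω) (hΩb : Bornology.IsBounded Ω)
    (I : Type*) [Nonempty I] (C : ℝ) (hC : 0 < C)
    (A : I → (Fin N → ℝ) → Matrix (Fin N) (Fin N) ℝ)
    (b : I → (Fin N → ℝ) → (Fin N → ℝ))
    (hAs : ∀ i, ∀ x ∈ closure Ω, (A i x).IsSymm)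
    (hAb : ∀ i, ∀ x ∈ closure Ω, matnorm (A i x) ≤ C)
    (hbb : ∀ i, ∀ x ∈ closure Ω, vnorm (b i x) ≤ C)
    (s : (Fin N → ℝ) → ℝ) (hs : ContDiff ℝ 2 s)
    (hs0 : ∀ x ∈ closure Ω, 0 ≤ s x)
    (hell : ∀ i, ∀ x ∈ closure Ω,
      1 ≤ dotProduct (vecMul (gradv s x) (A i x)) (gradv s x)) :
    ∃ α : ℝ, 1 ≤ α ∧
      ContDiff ℝ 2 (fun x => Real.exp (α * s x)) ∧
      (∀ x ∈ closure Ω, 1 ≤ Real.exp (α * s x)) ∧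
      ∀ i, ∀ x ∈ closure Ω,
        -(trace (A i x * hessv (fun x' => Real.exp (α * s x')) x))
          - dotProduct (b i x) (gradv (fun x' => Real.exp (α * s x')) x) ≤ -1 := by
  have hd : Differentiable ℝ s := hs.differentiable (by norm_num)
  have hcompact : IsCompact (closure Ω) := hΩb.isCompact_closure
  have hcont : Continuous fun x => ∑ i, ∑ j, |hessv s x j i| + ∑ j, |gradv s x j| :=
    (continuous_finsetSum _ fun i _ => continuous_finsetSum _ fun j _ =>
      (continuous_hessv_apply hs j i).abs).add
    (continuous_finsetSum _ fun j _ => (contDiff_gradv_apply hs j).continuous.abs)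
  obtain ⟨K, hK⟩ := hcompact.bddAbove_image hcont.continuousOn
  set M := max 0 (C * K)
  have hM : 0 ≤ M := le_max_left _ _
  refine ⟨M + 1, by linarith, (contDiff_const.mul hs).exp, fun x hx => ?_, fun i x hx => ?_⟩
  · exact Real.one_le_exp (mul_nonneg (by linarith) (hs0 x hx))
  have hψ : 1 ≤ Real.exp ((M + 1) * s x) :=
    Real.one_le_exp (mul_nonneg (by linarith) (hs0 x hx))
  have htr := neg_le_of_abs_le (abs_trace_mul_le (H := hessv s x) (hAb i x hx))
  have hdot := neg_le_of_abs_le (abs_dotProduct_le (w := gradv s x) (hbb i x hx))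
  have hlower : -M ≤ trace (A i x * hessv s x) + b i x ⬝ᵥ gradv s x := by
    have hbound := mul_le_mul_of_nonneg_left (hK (Set.mem_image_of_mem _ hx)) hC.le
    have hCK : C * K ≤ M := le_max_right _ _
    rw [mul_add] at hbound
    linarith
  rw [gradv_exp_mul hd, hessv_exp_mul hs, Matrix.mul_smul, Matrix.mul_add, Matrix.mul_smul,
    Matrix.mul_smul, trace_smul, trace_add, trace_smul, trace_smul, trace_mul_vecMulVec_self,
    dotProduct_smul]
  simp only [smul_eq_mul]
  have hq := hell i x hx
  generalize Real.exp ((M + 1) * s x) = ψ at hψ ⊢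
  generalize vecMul (gradv s x) (A i x) ⬝ᵥ gradv s x = q at hq ⊢
  generalize trace (A i x * hessv s x) = t at hlower ⊢
  generalize b i x ⬝ᵥ gradv s x = d at hlower ⊢
  have hmain : 1 ≤ (M + 1) ^ 2 * q + (M + 1) * (t + d) := by
    nlinarith [mul_le_mul_of_nonneg_left hq (sq_nonneg (M + 1)),
      mul_le_mul_of_nonneg_left hlower (show 0 ≤ M + 1 by linarith)]
  linarith [one_le_mul_of_one_le_of_one_le hψ hmain]
end

section
/- Let N be a positive integer and Ω ⊂ ℝᴺ a bounded open set. Let g⁺, h : ℝᴺ → ℝ be C¹ functions with g⁺(x) − h(x) ≥ m for all x ∈ Ω̄ and some m > 0. Let s : ℝᴺ → ℝ be C² with s ≥ 0, let β₀ : ℝᴺ → ℝ be C², and let K > 0. Suppose γ₁⁺ : Ω̄ × [−1,1] → ℝᴺ and β⁺ : Ω̄ × [−1,1] → ℝ satisfy |γ₁⁺(x,y)| ≤ K|y| and |β⁺(x,y) − β₀(x)| ≤ K|y| for all (x,y). For α > 1, Λ > 1, ε ∈ (0,1) define χ(x) := e^{α s(x)} and ψ(x,y) := C_D + e^{α·max_{Ω̄}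 s} − χ(x) + β₀(x)·y + αΛ·χ(x)·(y − ε h(x))², where C_D ≥ 0 is any constant. Then there exist Λ₀ > 1 and δ₀ ∈ (0,1) such that for every α > 1 and ε ∈ (0,1) with εα ≤ δ₀ and εΛ₀ < 1, taking Λ = Λ₀, one has for every x ∈ Ω̄, with y := ε g⁺(x): γ₁⁺(x,y)·D_xψ(x,y) + D_yψ(x,y) − β⁺(x,y) > 0. -/
open Matrix

/-- The supersolution candidate
`ψ(x,y) = C_D + e^{αS} − e^{αs(x)} + β₀(x)·y + αΛ·e^{αs(x)}·(y − εh(x))²`,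
as a function of `x` and `y` separately. -/
noncomputable def psiXY {N : ℕ} (s β₀ h : (Fin N → ℝ) → ℝ) (S Λ α C_D ε : ℝ)
    (x : Fin N → ℝ) (y : ℝ) : ℝ :=
  C_D + Real.exp (α * S) - Real.exp (α * s x) + β₀ x * y
    + α * Λ * Real.exp (α * s x) * (y - ε * h x) ^ 2

theorem norm_le_vnorm {n : ℕ} (v : Fin n → ℝ) : ‖v‖ ≤ vnorm v := by
  refine (pi_norm_le_iff_of_nonneg (Real.sqrt_nonneg _)).2 fun i => ?_
  rw [Real.norm_eq_abs, ← Real.sqrt_sq_eq_abs]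
  exact Real.sqrt_le_sqrt
    (Finset.single_le_sum (f := fun j => v j ^ 2) (fun j _ => sq_nonneg (v j)) (Finset.mem_univ i))

theorem dotProduct_gradv {n : ℕ} (f : (Fin n → ℝ) → ℝ) (x v : Fin n → ℝ) :
    dotProduct v (gradv f x) = fderiv ℝ f x v := by
  conv_rhs => rw [pi_eq_sum_univ' v]
  simp [dotProduct, gradv, map_sum, Pi.single]

/-- On a compact set, directional derivatives of a `C¹` function are uniformly controlled by the
Euclidean norm of the direction. -/
theorem exists_abs_fderiv_apply_le {n : ℕ} {k : Set (Fin n → ℝ)} (hk : IsCompact k)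
    {f : (Fin n → ℝ) → ℝ} (hf : ContDiff ℝ 1 f) :
    ∃ C, 0 ≤ C ∧ ∀ x ∈ k, ∀ v, |fderiv ℝ f x v| ≤ C * vnorm v := by
  obtain ⟨C, hC⟩ := hk.exists_bound_of_continuousOn (hf.continuous_fderiv one_ne_zero).continuousOn
  refine ⟨|C|, abs_nonneg C, fun x hx v => ?_⟩
  calc |fderiv ℝ f x v| ≤ ‖fderiv ℝ f x‖ * ‖v‖ := (fderiv ℝ f x).le_opNorm v
    _ ≤ |C| * vnorm v :=
      mul_le_mul ((hC x hx).trans (le_abs_self C)) (norm_le_vnorm v) (norm_nonneg _) (abs_nonneg C)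

theorem fderiv_psiXY_apply {N : ℕ} {s β₀ h : (Fin N → ℝ) → ℝ} {x : Fin N → ℝ}
    (hs : DifferentiableAt ℝ s x) (hβ₀ : DifferentiableAt ℝ β₀ x) (hh : DifferentiableAt ℝ h x)
    (S Λ α C_D ε y : ℝ) (v : Fin N → ℝ) :
    fderiv ℝ (fun x' => psiXY s β₀ h S Λ α C_D ε x' y) x v =
      -(α * Real.exp (α * s x) * fderiv ℝ s x v) + y * fderiv ℝ β₀ x v
        + α * Λ * Real.exp (α * s x) *
          (α * (y - ε * h x) ^ 2 * fderiv ℝ s x v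
            - 2 * ε * (y - ε * h x) * fderiv ℝ h x v) := by
  have hexp := (hs.hasFDerivAt.const_mul α).exp
  have hd := (((hh.hasFDerivAt.const_mul ε).const_sub y).pow 2)
  have key := ((hexp.const_sub (C_D + Real.exp (α * S))).add (hβ₀.hasFDerivAt.mul_const y)).add
    ((hexp.const_mul (α * Λ)).mul hd)
  have := key.fderiv
  unfold psiXY
  erw [this]
  simp
  ring

theorem deriv_psiXY {N : ℕ} (s β₀ h : (Fin N → ℝ) → ℝ) (S Λ α C_D ε : ℝ) (x : Fin N → ℝ) (y : ℝ) :
    deriv (fun y' => psiXY s β₀ h S Λ α C_D ε x y') y =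
      β₀ x + 2 * α * Λ * Real.exp (α * s x) * (y - ε * h x) := by
  have hd := (((hasDerivAt_id y).sub_const (ε * h x)).pow 2).const_mul
    (α * Λ * Real.exp (α * s x))
  have key := (((hasDerivAt_id y).const_mul (β₀ x)).const_add
    (C_D + Real.exp (α * S) - Real.exp (α * s x))).add hd
  unfold psiXY
  erw [key.deriv]
  simp
  ring

/-- Absorption of the error terms: `a` stands for `e^{αs}`, `d` for `g - h`, and `p`, `q`, `r` for
the derivatives of `s`, `β₀`, `h` along the tangential part of the oblique direction. -/
theorem boundary_terms_pos {m C Λ δ α ε a d g p q r b : ℝ} (hm : 0 < m) (hΛ : 0 < Λ)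
    (hΛC : 2 * C + C ^ 2 < Λ * m) (hδ : δ < 1) (hδC : δ * (C ^ 3 + 2 * C ^ 2) ≤ m)
    (hα : 1 < α) (hε : 0 < ε) (hεα : ε * α ≤ δ) (ha : 1 ≤ a) (hmd : m ≤ d) (hdC : d ≤ C)
    (hg : |g| ≤ C) (hp : |p| ≤ C * ε) (hq : |q| ≤ C * ε) (hr : |r| ≤ C * ε) (hb : |b| ≤ C * ε) :
    0 < -(α * a * p) + ε * g * q + α * Λ * a * (α * (ε * d) ^ 2 * p - 2 * ε * (ε * d) * r)
      + 2 * α * Λ * a * (ε * d) + b := by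
  have hd : 0 < d := hm.trans_le hmd
  have hC : 0 < C := hd.trans_le hdC
  have hεδ : ε ≤ δ := by nlinarith
  have hε1 : ε ≤ 1 := hεδ.trans hδ.le
  have hδ0 : 0 ≤ δ := hε.le.trans hεδ
  have hαa : 1 ≤ α * a := one_le_mul_of_one_le_of_one_le hα.le ha
  have h_main : ε * (2 * C + C ^ 2) < ε * (Λ * d) := by
    gcongr
    exact hΛC.trans_le (by gcongr)
  have h_quad : |α * ε ^ 2 * d ^ 2 * p| + |2 * ε ^ 2 * d * r| ≤ ε * (Λ * d) / Λ := by
    rw [abs_mul, abs_of_pos (by positivity : 0 < α * ε ^ 2 * d ^ 2), abs_mul,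
      abs_of_pos (by positivity : 0 < 2 * ε ^ 2 * d)]
    calc α * ε ^ 2 * d ^ 2 * |p| + 2 * ε ^ 2 * d * |r|
        ≤ α * ε ^ 2 * C ^ 2 * (C * ε) + 2 * ε ^ 2 * C * (C * ε) := by gcongr
      _ = ε * (ε * α * (ε * C ^ 3) + ε * (ε * (2 * C ^ 2))) := by ring
      _ ≤ ε * (δ * (1 * C ^ 3) + δ * (1 * (2 * C ^ 2))) := by gcongr
      _ = ε * (δ * (C ^ 3 + 2 * C ^ 2)) := by ring
      _ ≤ ε * d := by gcongr; exact hδC.trans hmd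
      _ = ε * (Λ * d) / Λ := by field_simp
  have h_gq : |ε * g * q| ≤ ε * C ^ 2 := by
    rw [abs_mul, abs_mul, abs_of_pos hε]
    calc ε * |g| * |q| ≤ 1 * C * (C * ε) := by gcongr
      _ = ε * C ^ 2 := by ring
  have h_bracket : ε * (C + C ^ 2) <
      -p + Λ * (α * ε ^ 2 * d ^ 2 * p - 2 * ε ^ 2 * d * r) + 2 * Λ * (ε * d) := by
    rw [le_div_iff₀' hΛ] at h_quad
    have : -(|α * ε ^ 2 * d ^ 2 * p| + |2 * ε ^ 2 * d * r|) ≤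
        α * ε ^ 2 * d ^ 2 * p - 2 * ε ^ 2 * d * r := by
      linarith [neg_abs_le (α * ε ^ 2 * d ^ 2 * p), le_abs_self (2 * ε ^ 2 * d * r)]
    have := mul_le_mul_of_nonneg_left this hΛ.le
    linarith [le_abs_self p]
  have h_scaled := le_mul_of_one_le_left
    (((by positivity : 0 < ε * (C + C ^ 2)).trans h_bracket).le) hαa
  linarith [neg_abs_le (ε * g * q), neg_abs_le b]

/-- the top-boundary estimate of Step 1 in the case `γ₀ = 0`:
for `Λ = Λ₀` large and `εα ≤ δ₀` small, `γ₁⁺·D_xψ + D_yψ − β⁺ > 0` on `{y = ε g⁺(x)}`. -/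
theorem stmt15 (N : ℕ) (hN : 0 < N) (Ω : Set (Fin N → ℝ))
    (hΩo : IsOpen Ω) (hΩb : Bornology.IsBounded Ω)
    (g h : (Fin N → ℝ) → ℝ) (hg : ContDiff ℝ 1 g) (hh : ContDiff ℝ 1 h)
    (m : ℝ) (hm : 0 < m) (hgap : ∀ x ∈ closure Ω, m ≤ g x - h x)
    (s : (Fin N → ℝ) → ℝ) (hs : ContDiff ℝ 2 s) (hs0 : ∀ x, 0 ≤ s x)
    (β₀ : (Fin N → ℝ) → ℝ) (hβ₀ : ContDiff ℝ 2 β₀)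
    (K : ℝ) (hK : 0 < K)
    (γ₁ : (Fin N → ℝ) → ℝ → (Fin N → ℝ)) (β : (Fin N → ℝ) → ℝ → ℝ)
    (hγ₁ : ∀ x ∈ closure Ω, ∀ y ∈ Set.Icc (-1 : ℝ) 1, vnorm (γ₁ x y) ≤ K * |y|)
    (hβ : ∀ x ∈ closure Ω, ∀ y ∈ Set.Icc (-1 : ℝ) 1, |β x y - β₀ x| ≤ K * |y|)
    (C_D : ℝ) (hCD : 0 ≤ C_D) :
    ∃ Λ₀ : ℝ, 1 < Λ₀ ∧ ∃ δ₀ ∈ Set.Ioo (0 : ℝ) 1,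
      ∀ α : ℝ, 1 < α → ∀ ε : ℝ, 0 < ε → ε < 1 → ε * α ≤ δ₀ → ε * Λ₀ < 1 →
        ∀ x ∈ closure Ω,
          0 < dotProduct (γ₁ x (ε * g x))
                (gradv (fun x' => psiXY s β₀ h (sSup (s '' closure Ω)) Λ₀ α C_D ε x' (ε * g x)) x)
              + deriv (fun y' => psiXY s β₀ h (sSup (s '' closure Ω)) Λ₀ α C_D ε x y') (ε * g x)
              - β x (ε * g x) := by
  have hk : IsCompact (closure Ω) := hΩb.isCompact_closure
  obtain ⟨G, hG⟩ := hk.exists_bound_of_continuousOn hg.continuous.continuousOn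
  obtain ⟨D, hD⟩ := hk.exists_bound_of_continuousOn (hg.continuous.sub hh.continuous).continuousOn
  obtain ⟨A, hA0, hA⟩ := exists_abs_fderiv_apply_le hk (hs.of_le one_le_two)
  obtain ⟨B, hB0, hB⟩ := exists_abs_fderiv_apply_le hk (hβ₀.of_le one_le_two)
  obtain ⟨H, hH0, hH⟩ := exists_abs_fderiv_apply_le hk hh
  obtain ⟨C, hC⟩ : ∃ C, C ∈ upperBounds {1, G, D, K * G, A * (K * G), B * (K * G), H * (K * G)} :=
    (Set.toFinite _).bddAbove
  simp only [mem_upperBounds, Set.mem_insert_iff, Set.mem_singleton_iff, forall_eq_or_imp,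
    forall_eq] at hC
  obtain ⟨hC1, hGC, hDC, hKC, hAC, hBC, hHC⟩ := hC
  have hCpos : 0 < C := one_pos.trans_le hC1
  refine ⟨1 + (2 * C + C ^ 2) / m, lt_add_of_pos_right _ (by positivity),
    m / (1 + m) / (C ^ 3 + 2 * C ^ 2), ⟨by positivity, ?_⟩, ?_⟩
  · rw [div_div, div_lt_one (by positivity)]
    nlinarith [one_le_pow₀ (n := 3) hC1, one_le_pow₀ (n := 2) hC1]
  intro α hα ε hε _ hεα _ x hx
  have hδ : m / (1 + m) / (C ^ 3 + 2 * C ^ 2) * (C ^ 3 + 2 * C ^ 2) = m / (1 + m) :=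
    div_mul_cancel₀ _ (by positivity)
  have hm1 : m / (1 + m) < 1 := (div_lt_one (by positivity)).2 (by linarith)
  generalize hδ_def : m / (1 + m) / (C ^ 3 + 2 * C ^ 2) = δ at hδ hεα
  have hδpos : 0 < δ := hδ_def ▸ by positivity
  have hδC : δ * C < 1 := by
    refine lt_of_le_of_lt ?_ (hδ.trans_lt hm1)
    gcongr
    nlinarith [one_le_pow₀ (n := 2) hC1]
  have hgC : |g x| ≤ C := (hG x hx).trans hGC
  have hεδ : ε ≤ δ := by nlinarith
  have hG0 : 0 ≤ G := (norm_nonneg _).trans (hG x hx)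
  have hεg : |ε * g x| ≤ ε * G := by
    rw [abs_mul, abs_of_pos hε]
    exact mul_le_mul_of_nonneg_left (hG x hx) hε.le
  have hy : ε * g x ∈ Set.Icc (-1 : ℝ) 1 := by
    refine abs_le.1 (hεg.trans ?_)
    calc ε * G ≤ δ * C := by gcongr
      _ ≤ 1 := hδC.le
  have hγ : vnorm (γ₁ x (ε * g x)) ≤ K * (ε * G) := (hγ₁ x hx _ hy).trans (by gcongr)
  have tangential_le {f : (Fin N → ℝ) → ℝ} {M : ℝ} (hM : 0 ≤ M) (hMC : M * (K * G) ≤ C)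
      (hf : ∀ x ∈ closure Ω, ∀ v, |fderiv ℝ f x v| ≤ M * vnorm v) :
      |fderiv ℝ f x (γ₁ x (ε * g x))| ≤ C * ε :=
    calc |fderiv ℝ f x (γ₁ x (ε * g x))| ≤ M * vnorm (γ₁ x (ε * g x)) := hf x hx _
      _ ≤ M * (K * (ε * G)) := by gcongr
      _ = M * (K * G) * ε := by ring
      _ ≤ C * ε := by gcongr
  have hb : |β₀ x - β x (ε * g x)| ≤ C * ε := by
    rw [abs_sub_comm]
    calc |β x (ε * g x) - β₀ x| ≤ K * (ε * G) := (hβ x hx _ hy).trans (by gcongr)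
      _ = K * G * ε := by ring
      _ ≤ C * ε := by gcongr
  have hpos := boundary_terms_pos (Λ := 1 + (2 * C + C ^ 2) / m) (δ := δ) (C := C) hm
    (by positivity) (by rw [add_mul, div_mul_cancel₀ _ hm.ne']; linarith)
    ((le_mul_of_one_le_right hδpos.le hC1).trans_lt hδC)
    (by rw [hδ]; exact div_le_self hm.le (by linarith)) hα hε hεα
    (Real.one_le_exp (mul_nonneg (one_pos.trans hα).le (hs0 x))) (hgap x hx)
    ((le_abs_self _).trans ((hD x hx).trans hDC)) hgC (tangential_le hA0 hAC hA)
    (tangential_le hB0 hBC hB) (tangential_le hH0 hHC hH) hb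
  rw [dotProduct_gradv, fderiv_psiXY_apply (hs.differentiable two_ne_zero x)
    (hβ₀.differentiable two_ne_zero x) (hh.differentiable one_ne_zero x), deriv_psiXY, ← mul_sub]
  linarith
end
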